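/- Let N ≥ 1, let φ : Fin N → ℝ be such that e^{i(φ_k − φ_{k′})} ≠ 1 for all k ≠ k′, and let F be the diagonal N×N complex matrix with entries F_{kk} = e^{−iφ_k}. Then for every N×N complex matrix ρ and every N×N complex matrix O, the Cèsaro averages (1/N')·Σ_{j=0}^{N'−1} Tr(F^j ρ (F^j)† O) converge, as N' → ∞, to Tr(ρ_* O), where ρ_* is the diagonal part of ρ (the diagonal matrix with entries (ρ_*)_{kk} = ρ_{kk}). -/

import Mathlib

open Matrix Filter Topology

/-- Cesàro averages of the powers of a unimodular number tend to `1` or `0`. -/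
theorem tendsto_cesaro_pow_of_norm_eq_one {z : ℂ} (hz : ‖z‖ = 1) :
    Tendsto (fun n : ℕ => (1 / (n : ℂ)) * ∑ j ∈ Finset.range n, z ^ j)
      atTop (𝓝 (if z = 1 then 1 else 0)) := by
  split_ifs with h
  · subst h
    refine tendsto_const_nhds.congr' ?_
    filter_upwards [eventually_ne_atTop 0] with n hn
    simp [hn]
  · refine squeeze_zero_norm (a := fun n : ℕ => (2 / ‖z - 1‖) / (n : ℝ)) (fun n => ?_)
      (tendsto_const_div_atTop_nhds_zero_nat _)
    rw [geom_sum_eq h, norm_mul, norm_div, norm_div, norm_one, Complex.norm_natCast,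
      one_div_mul_eq_div]
    gcongr
    calc ‖z ^ n - 1‖ ≤ ‖z ^ n‖ + ‖(1 : ℂ)‖ := norm_sub_le _ _
      _ = 2 := by rw [norm_pow, hz]; norm_num

/-- The trace of a diagonally evolved matrix against an observable, entry by entry. -/
theorem trace_diagonal_pow_conj_mul {ι : Type*} [Fintype ι] [DecidableEq ι]
    (d : ι → ℂ) (ρ O : Matrix ι ι ℂ) (j : ℕ) :
    (diagonal d ^ j * ρ * (diagonal d ^ j)ᴴ * O).trace =
      ∑ k, ∑ l, (d k * star (d l)) ^ j * (ρ k l * O l k) := by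
  rw [diagonal_pow, diagonal_conjTranspose]
  simp only [trace, diag_apply, mul_apply (N := O), mul_diagonal, diagonal_mul, Pi.pow_apply,
    Pi.star_apply, star_pow, mul_pow]
  exact Finset.sum_congr rfl fun k _ => Finset.sum_congr rfl fun l _ => by ring

/-- Ergodicity of the kicked rotator in the Floquet eigenbasis: if the eigenphases are
nondegenerate (`e^{i(φ_k − φ_{k′})} ≠ 1` for `k ≠ k′`), then for every state `ρ` and
observable `O` the Cèsaro averages of the mean values converge to `Tr(ρ_* O)`, where
`ρ_*` is the diagonal part of `ρ`. -/
theorem kicked_rotator_cesaro_limit_diagonal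
    (N : ℕ) (hN : 1 ≤ N) (φ : Fin N → ℝ)
    (hφ : ∀ k k' : Fin N, k ≠ k' →
      Complex.exp (Complex.I * ((φ k : ℂ) - (φ k' : ℂ))) ≠ 1)
    (F : Matrix (Fin N) (Fin N) ℂ)
    (hF : F = Matrix.diagonal fun k => Complex.exp (-(Complex.I * (φ k)))) :
    ∀ ρ O : Matrix (Fin N) (Fin N) ℂ,
      Tendsto (fun N' : ℕ =>
          (1 / (N' : ℂ)) * ∑ j ∈ Finset.range N', (F ^ j * ρ * (F ^ j)ᴴ * O).trace)
        atTop (𝓝 ((Matrix.diagonal (fun k => ρ k k) * O).trace)) := by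
  intro ρ O
  subst hF
  set d : Fin N → ℂ := fun k => Complex.exp (-(Complex.I * (φ k))) with hd
  have hw (k l : Fin N) :
      d k * star (d l) = Complex.exp (Complex.I * ((φ l : ℂ) - (φ k : ℂ))) := by
    simp only [hd, Complex.star_def, ← Complex.exp_conj, ← Complex.exp_add, map_neg, map_mul,
      Complex.conj_I, Complex.conj_ofReal]
    ring_nf
  have hnorm (k l : Fin N) : ‖d k * star (d l)‖ = 1 := by
    rw [hw, ← Complex.ofReal_sub, Complex.norm_exp_I_mul_ofReal]
  have hone (k l : Fin N) : d k * star (d l) = 1 ↔ k = l := by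
    rw [hw]
    refine ⟨fun h => by_contra fun hkl => hφ l k (Ne.symm hkl) h, ?_⟩
    rintro rfl
    simp
  have hlim : (diagonal (fun k => ρ k k) * O).trace =
      ∑ k, ∑ l, (if d k * star (d l) = 1 then 1 else 0) * (ρ k l * O l k) := by
    simp only [hone]
    simp [trace, diagonal_mul]
  rw [hlim]
  refine (tendsto_finsetSum _ fun k _ => tendsto_finsetSum _ fun l _ =>
    (tendsto_cesaro_pow_of_norm_eq_one (hnorm k l)).mul_const (ρ k l * O l k)).congr fun n => ?_
  simp only [trace_diagonal_pow_conj_mul]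
  simp only [mul_assoc (1 / (n : ℂ)), Finset.sum_mul, ← Finset.mul_sum]
  congr 1
  symm
  rw [Finset.sum_comm]
  exact Finset.sum_congr rfl fun k _ => Finset.sum_comm
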